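/- arXiv:1011.3414 — 6 statements merged into one kernel-verified Lean document; each statement's English description precedes it below -/
import Mathlib

section
/- Suppose the maximal solution U^u : [0, τ(u)) → ℝ^d of system (1.1) blows up in finite time (τ(u) < ∞). Then U_d^u(t) → +∞ as t → τ(u)⁻, and moreover all coordinates of U^u are bounded below on [0, τ(u)): there exists ρ ∈ ℝ such that U_k^u(t) ≥ ρ for every k ∈ {1,…,d} and every t ∈ [0, τ(u)). -/
open scoped BigOperators
open Filter Topology Set

/-- The `n`-th coordinate (0-based) of a vector in `ℝ^d`, with junk value `0` out of range. -/
noncomputable def coordFn {d : ℕ} (u : Fin d → ℝ) (n : ℕ) : ℝ :=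
  if hn : n < d then u ⟨n, hn⟩ else 0

/-- The vector field `b` of system (1.1) (0-based indices: coordinate `1 ≤ k ≤ d` of the paper
is coordinate `k - 1` here). -/
noncomputable def bField (d : ℕ) (h p : ℝ) (u : Fin d → ℝ) (i : Fin d) : ℝ :=
  if (i : ℕ) = 0 then (2 / h ^ 2) * (-coordFn u 0 + coordFn u 1)
  else if (i : ℕ) = d - 1 then
    (2 / h ^ 2) * (-coordFn u (d - 1) + coordFn u (d - 2)
      + h * ((max (coordFn u (d - 1)) 0) ^ p - coordFn u (d - 1)))
  else (1 / h ^ 2) * (coordFn u ((i : ℕ) + 1) - 2 * coordFn u (i : ℕ) + coordFn u ((i : ℕ) - 1))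

/-- The Euclidean norm on `ℝ^d`. -/
noncomputable def euclNorm {d : ℕ} (u : Fin d → ℝ) : ℝ := Real.sqrt (∑ i, (u i) ^ 2)

/-- `u` belongs to the domain of explosion `D_e`: the (unique, maximal) solution of (1.1)
starting at `u` blows up in finite time, i.e. there are `τ < ∞` and a solution `U` of (1.1)
on `[0, τ)` with `U(0) = u` and `|U(t)| → ∞` as `t → τ⁻`. -/
def BlowsUp (d : ℕ) (h p : ℝ) (u : Fin d → ℝ) : Prop :=
  ∃ (τ : ℝ) (U : ℝ → Fin d → ℝ), 0 < τ ∧ U 0 = u ∧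
    (∀ t ∈ Set.Ico 0 τ, HasDerivWithinAt U (bField d h p (U t)) (Set.Ico 0 τ) t) ∧
    Filter.Tendsto (fun t => euclNorm (U t)) (nhdsWithin τ (Set.Iio τ)) Filter.atTop

/-- The (unique, maximal) solution of (1.1) starting at `u` is global and converges to `L`
as `t → ∞`. -/
def GlobalTo (d : ℕ) (h p : ℝ) (u L : Fin d → ℝ) : Prop :=
  ∃ U : ℝ → Fin d → ℝ, U 0 = u ∧
    (∀ t : ℝ, 0 ≤ t → HasDerivWithinAt U (bField d h p (U t)) (Set.Ici 0) t) ∧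
    Filter.Tendsto U Filter.atTop (nhds L)

/-- In range, `coordFn` is evaluation. -/
theorem coordFn_of_lt {d : ℕ} (u : Fin d → ℝ) {n : ℕ} (hn : n < d) :
    coordFn u n = u ⟨n, hn⟩ := dif_pos hn

/-- Off the last coordinate, `b` is nonpositive at a maximal coordinate. -/
theorem bField_nonpos_of_forall_le {d : ℕ} (h p : ℝ) (hd : 2 ≤ d) {u : Fin d → ℝ} {i : Fin d}
    (hi : (i : ℕ) ≠ d - 1) (hmax : ∀ j, u j ≤ u i) : bField d h p u i ≤ 0 := by
  have hilt := i.isLt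
  rw [bField]
  split_ifs with h0
  · have hi0 : u ⟨0, by omega⟩ = u i := congrArg u (Fin.ext h0.symm)
    have h1 := hmax ⟨1, by omega⟩
    rw [coordFn_of_lt u (by omega : 0 < d), coordFn_of_lt u (by omega : 1 < d), hi0]
    exact mul_nonpos_of_nonneg_of_nonpos (by positivity) (by linarith)
  · have h1 := hmax ⟨i + 1, by omega⟩
    have h2 := hmax ⟨i - 1, by omega⟩
    rw [coordFn_of_lt u (by omega : (i : ℕ) + 1 < d), coordFn_of_lt u hilt,
      coordFn_of_lt u (by omega : (i : ℕ) - 1 < d)]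
    exact mul_nonpos_of_nonneg_of_nonpos (by positivity) (by linarith)

/-- The last component of `b` in terms of coordinates. -/
theorem bField_last {d : ℕ} (h p : ℝ) (hd : 2 ≤ d) (u : Fin d → ℝ) :
    bField d h p u ⟨d - 1, by omega⟩ = (2 / h ^ 2) * (-u ⟨d - 1, by omega⟩ + u ⟨d - 2, by omega⟩
      + h * ((max (u ⟨d - 1, by omega⟩) 0) ^ p - u ⟨d - 1, by omega⟩)) := by
  rw [bField, if_neg (by simp only; omega), if_pos rfl, coordFn_of_lt u (by omega : d - 1 < d),
    coordFn_of_lt u (by omega : d - 2 < d)]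

/-- `b` is nonnegative at a nonpositive minimal coordinate. -/
theorem bField_nonneg_of_forall_ge {d : ℕ} {h : ℝ} (p : ℝ) (hh : 0 < h) (hd : 2 ≤ d)
    {u : Fin d → ℝ} {i : Fin d} (hi : u i ≤ 0) (hmin : ∀ j, u i ≤ u j) :
    0 ≤ bField d h p u i := by
  have hilt := i.isLt
  by_cases hl : (i : ℕ) = d - 1
  · have hlt : d - 1 < d := by omega
    obtain rfl : i = ⟨d - 1, hlt⟩ := Fin.ext hl
    rw [bField_last h p hd]
    have h1 := hmin ⟨d - 2, by omega⟩
    have h2 : 0 ≤ (max (u ⟨d - 1, by omega⟩) 0) ^ p := Real.rpow_nonneg (le_max_right _ _) _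
    have h3 : 0 ≤ h * ((max (u ⟨d - 1, by omega⟩) 0) ^ p - u ⟨d - 1, by omega⟩) :=
      mul_nonneg hh.le (by linarith)
    exact mul_nonneg (by positivity) (by linarith)
  · rw [bField, if_neg hl]
    split_ifs with h0
    · have hi0 : u ⟨0, by omega⟩ = u i := congrArg u (Fin.ext h0.symm)
      have h1 := hmin ⟨1, by omega⟩
      rw [coordFn_of_lt u (by omega : 0 < d), coordFn_of_lt u (by omega : 1 < d), hi0]
      exact mul_nonneg (by positivity) (by linarith)
    · have h1 := hmin ⟨i + 1, by omega⟩
      have h2 := hmin ⟨i - 1, by omega⟩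
      rw [coordFn_of_lt u (by omega : (i : ℕ) + 1 < d), coordFn_of_lt u hilt,
        coordFn_of_lt u (by omega : (i : ℕ) - 1 < d)]
      exact mul_nonneg (by positivity) (by linarith)

/-- A function that attains at `b` its maximum over `[a, b]` has nonnegative left derivative. -/
theorem HasDerivWithinAt.nonneg_of_forall_le_left {f : ℝ → ℝ} {f' a b : ℝ} (hab : a < b)
    (hf : HasDerivWithinAt f f' (Set.Icc a b) b) (hle : ∀ t ∈ Set.Ico a b, f t ≤ f b) :
    0 ≤ f' := by
  have h1 := hasDerivWithinAt_iff_tendsto_slope.1 (hf.mono Set.Ico_subset_Icc_self)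
  rw [Set.sdiff_singleton_eq_self (by simp)] at h1
  have : (𝓝[Set.Ico a b] b).NeBot := by
    rw [nhdsWithin_Ico_eq_nhdsLT hab]; infer_instance
  refine ge_of_tendsto h1 ?_
  filter_upwards [self_mem_nhdsWithin] with t ht
  rw [slope_def_field]
  exact div_nonneg_of_nonpos (by linarith [hle t ht]) (by linarith [ht.2])

/-- Maximum principle: if every maximal coordinate lying above `c` has nonpositive derivative,
then a curve starting below `c` stays below `c`. -/
theorem forall_le_of_deriv_nonpos_at_max {ι : Type*} [Fintype ι] {f f' : ℝ → ι → ℝ} {τ c : ℝ}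
    (hf : ∀ t ∈ Set.Ico 0 τ, HasDerivWithinAt f (f' t) (Set.Ico 0 τ) t)
    (h0 : ∀ k, f 0 k ≤ c)
    (hmax : ∀ t ∈ Set.Ico 0 τ, ∀ k, c < f t k → (∀ j, f t j ≤ f t k) → f' t k ≤ 0) :
    ∀ t ∈ Set.Ico 0 τ, ∀ k, f t k ≤ c := by
  have key : ∀ ε : ℝ, 0 < ε → ∀ t ∈ Set.Ico 0 τ, ∀ k, f t k < c + ε * (1 + t) := by
    intro ε hε T hT k
    by_contra! hk
    have hsub : Set.Icc 0 T ⊆ Set.Ico 0 τ := fun t ht => ⟨ht.1, ht.2.trans_lt hT.2⟩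
    have hcont : ∀ j, ContinuousOn (fun t => f t j) (Set.Icc 0 T) := fun j t ht =>
      (((hasDerivWithinAt_pi.1 (hf t (hsub ht))) j).continuousWithinAt).mono hsub
    let S : Set ℝ := ⋃ j, {t ∈ Set.Icc 0 T | c + ε * (1 + t) ≤ f t j}
    have hS : IsCompact S := by
      refine isCompact_iUnion fun j => ?_
      refine isCompact_Icc.of_isClosed_subset ?_ (Set.sep_subset _ _)
      exact isClosed_Icc.isClosed_le (by fun_prop) (hcont j)
    have hne : S.Nonempty := ⟨T, Set.mem_iUnion.2 ⟨k, ⟨hT.1, le_rfl⟩, hk⟩⟩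
    obtain ⟨s, hs, hsmin⟩ := hS.exists_isLeast hne
    obtain ⟨i, hsT, hi⟩ := Set.mem_iUnion.1 hs
    have hs0 : 0 < s := by
      refine lt_of_le_of_ne hsT.1 fun hs0 => ?_
      rw [← hs0] at hi
      linarith [h0 i]
    have hbefore : ∀ t ∈ Set.Ico 0 s, ∀ j, f t j < c + ε * (1 + t) := by
      intro t ht j
      by_contra! hcon
      exact ht.2.not_ge (hsmin (Set.mem_iUnion.2 ⟨j, ⟨ht.1, ht.2.le.trans hsT.2⟩, hcon⟩))
    have hat : ∀ j, f s j ≤ c + ε * (1 + s) := by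
      intro j
      have : (𝓝[Set.Ico 0 s] s).NeBot := by
        rw [nhdsWithin_Ico_eq_nhdsLT hs0]; infer_instance
      have hss : Set.Ico 0 s ⊆ Set.Icc 0 T := fun t ht => ⟨ht.1, ht.2.le.trans hsT.2⟩
      have hlim : Tendsto (fun t => c + ε * (1 + t)) (𝓝[Set.Ico 0 s] s)
          (𝓝 (c + ε * (1 + s))) :=
        (by fun_prop : Continuous fun t : ℝ => c + ε * (1 + t)).continuousWithinAt
      refine le_of_tendsto_of_tendsto ((hcont j s hsT).mono hss) hlim ?_
      filter_upwards [self_mem_nhdsWithin] with t ht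
      exact (hbefore t ht j).le
    have hnonpos : f' s i ≤ 0 :=
      hmax s (hsub hsT) i (by nlinarith) fun j => (hat j).trans hi
    have hlin : HasDerivAt (fun t : ℝ => c + ε * (1 + t)) ε s := by
      simpa using (((hasDerivAt_id s).const_add 1).const_mul ε).const_add c
    have hder : HasDerivWithinAt (fun t => f t i - (c + ε * (1 + t))) (f' s i - ε)
        (Set.Icc 0 s) s :=
      (((hasDerivWithinAt_pi.1 (hf s (hsub hsT))) i).mono
        fun t ht => hsub ⟨ht.1, ht.2.trans hsT.2⟩).sub hlin.hasDerivWithinAt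
    have hnonneg := hder.nonneg_of_forall_le_left hs0 fun t ht => by
      linarith [hbefore t ht i]
    linarith
  intro t ht k
  refine le_of_forall_pos_lt_add fun δ hδ => ?_
  have h1 : 0 < 1 + t := by linarith [ht.1]
  have h2 := key (δ / (1 + t)) (by positivity) t ht k
  rwa [div_mul_cancel₀ _ h1.ne'] at h2

/-- A vector with coordinates bounded in absolute value has bounded Euclidean norm. -/
theorem euclNorm_le_of_forall_abs_le {d : ℕ} {u : Fin d → ℝ} {B : ℝ} (hB : ∀ i, |u i| ≤ B) :
    euclNorm u ≤ Real.sqrt (d * B ^ 2) := by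
  refine Real.sqrt_le_sqrt ?_
  calc ∑ i, u i ^ 2 ≤ ∑ _i : Fin d, B ^ 2 := Finset.sum_le_sum fun i _ =>
        sq_le_sq' (by linarith [abs_le.1 (hB i)]) (abs_le.1 (hB i)).2
    _ = d * B ^ 2 := by simp

/-- Solutions of (1.1) on `[0, τ)` are bounded below. -/
theorem exists_forall_le_of_solution {d : ℕ} (hd : 2 ≤ d) {h p : ℝ} (hh : 0 < h) {τ : ℝ}
    {U : ℝ → Fin d → ℝ}
    (hsol : ∀ t ∈ Set.Ico 0 τ, HasDerivWithinAt U (bField d h p (U t)) (Set.Ico 0 τ) t) :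
    ∃ ρ : ℝ, ∀ t ∈ Set.Ico 0 τ, ∀ k, ρ ≤ U t k := by
  obtain ⟨c, hc⟩ := (Set.finite_range (-U 0)).bddAbove
  refine ⟨-max c 0, ?_⟩
  have h1 := forall_le_of_deriv_nonpos_at_max (c := max c 0) (f := fun t => -U t)
    (f' := fun t => -bField d h p (U t)) (fun t ht => (hsol t ht).neg)
    (fun k => (hc (Set.mem_range_self k)).trans (le_max_left _ _)) ?_
  · intro t ht k
    exact neg_le.1 (h1 t ht k)
  · intro t ht k hk hmax
    have h2 := (le_max_right c 0).trans_lt hk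
    simp only [Pi.neg_apply, neg_le_neg_iff, Left.neg_pos_iff, Left.neg_nonpos_iff] at *
    exact bField_nonneg_of_forall_ge p hh hd h2.le hmax

/-- A solution of (1.1) on `[0, τ)` whose last coordinate is bounded above is bounded above. -/
theorem exists_forall_ge_of_solution {d : ℕ} (hd : 2 ≤ d) {h p : ℝ} {τ : ℝ}
    {U : ℝ → Fin d → ℝ}
    (hsol : ∀ t ∈ Set.Ico 0 τ, HasDerivWithinAt U (bField d h p (U t)) (Set.Ico 0 τ) t)
    {K : ℝ} (hK : ∀ t ∈ Set.Ico 0 τ, U t ⟨d - 1, by omega⟩ ≤ K) :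
    ∃ R : ℝ, ∀ t ∈ Set.Ico 0 τ, ∀ k, U t k ≤ R := by
  obtain ⟨c, hc⟩ := (Set.finite_range (U 0)).bddAbove
  refine ⟨max c K, forall_le_of_deriv_nonpos_at_max hsol
    (fun k => (hc (Set.mem_range_self k)).trans (le_max_left _ _)) ?_⟩
  intro t ht k hk hmax
  refine bField_nonpos_of_forall_le h p hd (fun hl => ?_) hmax
  have hlt : d - 1 < d := by omega
  obtain rfl : k = ⟨d - 1, hlt⟩ := Fin.ext hl
  exact ((hK t ht).trans (le_max_right c K)).not_gt hk

/-- A function unbounded above on `[0, τ)` whose derivative is at least `-C * (f - a)` tends to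
infinity at `τ`. -/
theorem tendsto_atTop_of_neg_mul_le_deriv {f f' : ℝ → ℝ} {τ C a : ℝ} (hC : 0 ≤ C)
    (hf : ∀ t ∈ Set.Ico 0 τ, HasDerivWithinAt f (f' t) (Set.Ico 0 τ) t)
    (hf' : ∀ t ∈ Set.Ico 0 τ, -C * (f t - a) ≤ f' t)
    (hunb : ∀ K, ∃ t ∈ Set.Ico 0 τ, K < f t) :
    Tendsto f (𝓝[<] τ) atTop := by
  have hexp : ∀ t, HasDerivAt (fun t => Real.exp (C * t)) (Real.exp (C * t) * C) t := fun t => by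
    simpa using ((hasDerivAt_id t).const_mul C).exp
  have hder : ∀ t ∈ Set.Ico 0 τ, HasDerivWithinAt (fun t => Real.exp (C * t) * (f t - a))
      (Real.exp (C * t) * C * (f t - a) + Real.exp (C * t) * f' t) (Set.Ico 0 τ) t :=
    fun t ht => (hexp t).hasDerivWithinAt.mul ((hf t ht).sub_const a)
  have hmono : MonotoneOn (fun t => Real.exp (C * t) * (f t - a)) (Set.Ico 0 τ) := by
    refine monotoneOn_of_hasDerivWithinAt_nonneg (convex_Ico 0 τ)
      (fun t ht => (hder t ht).continuousWithinAt)
      (fun t ht => (hder t (interior_subset ht)).mono interior_subset) fun t ht => ?_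
    have h1 := mul_le_mul_of_nonneg_left (hf' t (interior_subset ht)) (Real.exp_pos (C * t)).le
    linarith
  refine tendsto_atTop.2 fun B => ?_
  obtain ⟨s, hs, hsB⟩ := hunb (a + Real.exp (C * τ) * |B - a|)
  filter_upwards [Ico_mem_nhdsLT hs.2] with t ht
  have h1 := hmono hs ⟨hs.1.trans ht.1, ht.2⟩ ht.1
  have h2 : 1 ≤ Real.exp (C * s) := Real.one_le_exp (mul_nonneg hC hs.1)
  have h3 : Real.exp (C * t) ≤ Real.exp (C * τ) := by
    gcongr
    exact ht.2.le
  have h4 : Real.exp (C * t) * |B - a| ≤ Real.exp (C * t) * (f t - a) := by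
    have h5 := mul_le_mul_of_nonneg_right h3 (abs_nonneg (B - a))
    have h6 : 0 ≤ f s - a := by
      have : 0 ≤ Real.exp (C * τ) * |B - a| := by positivity
      linarith
    have h7 := le_mul_of_one_le_left h6 h2
    simp only at h1
    linarith
  have h5 := le_of_mul_le_mul_left h4 (Real.exp_pos _)
  linarith [le_abs_self (B - a)]

/-- if the maximal solution `U` of (1.1) blows up at a finite time `τ`
(i.e. `U` solves (1.1) on `[0,τ)` and `|U(t)| → ∞` as `t → τ⁻`), then its last coordinate
tends to `+∞` as `t → τ⁻` and all coordinates are bounded below on `[0,τ)`. -/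
theorem stmt14 (d : ℕ) (hd : 2 ≤ d) (h p : ℝ) (hh : 0 < h) (hp : 1 < p)
    (τ : ℝ) (hτ : 0 < τ) (U : ℝ → Fin d → ℝ)
    (hsol : ∀ t ∈ Set.Ico 0 τ, HasDerivWithinAt U (bField d h p (U t)) (Set.Ico 0 τ) t)
    (hblow : Filter.Tendsto (fun t => euclNorm (U t)) (nhdsWithin τ (Set.Iio τ))
      Filter.atTop) :
    Filter.Tendsto (fun t => coordFn (U t) (d - 1)) (nhdsWithin τ (Set.Iio τ))
      Filter.atTop ∧
    ∃ ρ : ℝ, ∀ k : Fin d, ∀ t ∈ Set.Ico 0 τ, ρ ≤ U t k := by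
  obtain ⟨ρ, hρ⟩ := exists_forall_le_of_solution hd hh hsol
  refine ⟨?_, ρ, fun k t ht => hρ t ht k⟩
  have hlt : d - 1 < d := by omega
  simp only [coordFn_of_lt _ hlt]
  have hC : 0 < 2 / h ^ 2 * (1 + h) := by positivity
  refine tendsto_atTop_of_neg_mul_le_deriv (C := 2 / h ^ 2 * (1 + h)) (a := ρ / (1 + h))
    hC.le (fun t ht => (hasDerivWithinAt_pi.1 (hsol t ht)) ⟨d - 1, hlt⟩) ?_ ?_
  · intro t ht
    rw [bField_last h p hd]
    have h1 := hρ t ht ⟨d - 2, by omega⟩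
    have h2 : 0 ≤ h * (max (U t ⟨d - 1, hlt⟩) 0) ^ p :=
      mul_nonneg hh.le (Real.rpow_nonneg (le_max_right _ _) _)
    have h3 : -(2 / h ^ 2 * (1 + h)) * (U t ⟨d - 1, hlt⟩ - ρ / (1 + h))
        = 2 / h ^ 2 * (ρ - (1 + h) * U t ⟨d - 1, hlt⟩) := by
      field_simp
      ring
    rw [h3]
    exact mul_le_mul_of_nonneg_left (by linarith) (by positivity)
  · intro K
    by_contra! hK
    obtain ⟨R, hR⟩ := exists_forall_ge_of_solution hd hsol hK
    have hbdd : ∀ t ∈ Set.Ico 0 τ, euclNorm (U t) ≤ Real.sqrt (d * (max |ρ| |R|) ^ 2) :=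
      fun t ht => euclNorm_le_of_forall_abs_le fun i =>
        abs_le_max_abs_abs (hρ t ht i) (hR t ht i)
    obtain ⟨t, ht, htτ⟩ := ((hblow.eventually_gt_atTop _).and (Ico_mem_nhdsLT hτ)).exists
    exact (hbdd t htτ).not_gt ht
end

section
/- Every solution of the linear system (L) converges to the origin: if Y : [0,∞) → ℝ^d is differentiable and satisfies Y_1'(t) = (2/h²)(−Y_1(t) + Y_2(t)), Y_i'(t) = (1/h²)(Y_{i+1}(t) − 2Y_i(t) + Y_{i−1}(t)) for 2 ≤ i ≤ d−1, and Y_d'(t) = (2/h²)(−Y_d(t) + Y_{d−1}(t)) − (2/h)Y_d(t) for all t ≥ 0, then Y is bounded and Y(t) → 0 as t → ∞. -/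
open scoped BigOperators
open Filter Topology Set

/-- The vector field of the linear system (L) (0-based indices). -/
noncomputable def lField (d : ℕ) (h : ℝ) (u : Fin d → ℝ) (i : Fin d) : ℝ :=
  if (i : ℕ) = 0 then (2 / h ^ 2) * (-coordFn u 0 + coordFn u 1)
  else if (i : ℕ) = d - 1 then
    (2 / h ^ 2) * (-coordFn u (d - 1) + coordFn u (d - 2)) - (2 / h) * coordFn u (d - 1)
  else (1 / h ^ 2) * (coordFn u ((i : ℕ) + 1) - 2 * coordFn u (i : ℕ) + coordFn u ((i : ℕ) - 1))

/-- Discrete integration by parts for the Neumann Laplacian on `{0, …, m + 1}`. -/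
theorem sum_mul_laplacian_eq_neg_sum_sq (y : ℕ → ℝ) (m : ℕ) :
    y 0 * (-y 0 + y 1)
      + ∑ k ∈ Finset.range m, y (k + 1) * (y (k + 2) - 2 * y (k + 1) + y k)
      + y (m + 1) * (-y (m + 1) + y m)
    = -∑ k ∈ Finset.range (m + 1), (y (k + 1) - y k) ^ 2 := by
  induction m with
  | zero => simp; ring
  | succ m ih =>
    rw [Finset.sum_range_succ, Finset.sum_range_succ _ (m + 1)]
    linear_combination ih

/-- A discrete Poincaré inequality with a boundary term at the right end point. -/
theorem sq_le_two_pow_mul_sum_sq (y : ℕ → ℝ) (n k : ℕ) (hk : k ≤ n) :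
    y k ^ 2 ≤ 2 ^ n * (y n ^ 2 + ∑ j ∈ Finset.range n, (y (j + 1) - y j) ^ 2) := by
  induction n with
  | zero =>
    obtain rfl : k = 0 := by omega
    simp
  | succ n ih =>
    have hS : 0 ≤ ∑ j ∈ Finset.range n, (y (j + 1) - y j) ^ 2 :=
      Finset.sum_nonneg fun _ _ => sq_nonneg _
    rw [Finset.sum_range_succ]
    rcases Nat.lt_or_ge n k with hlt | hle
    · obtain rfl : k = n + 1 := by omega
      have h1 : (1 : ℝ) ≤ 2 ^ (n + 1) := one_le_pow₀ (by norm_num)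
      nlinarith [sq_nonneg (y (n + 1)), sq_nonneg (y (n + 1) - y n)]
    · refine (ih hle).trans ?_
      rw [pow_succ (2 : ℝ) n, mul_assoc]
      gcongr
      nlinarith [sq_nonneg (y (n + 1) + (y (n + 1) - y n))]

/-- The weighted energy of the grid function `y` on `{0, …, m + 1}`, the end points having
weight `1 / 2`. -/
noncomputable def gridEnergy (m : ℕ) (y : ℕ → ℝ) : ℝ :=
  y 0 ^ 2 / 2 + ∑ k ∈ Finset.range m, y (k + 1) ^ 2 + y (m + 1) ^ 2 / 2

theorem sq_le_two_mul_gridEnergy (m : ℕ) (y : ℕ → ℝ) (k : ℕ) (hk : k ≤ m + 1) :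
    y k ^ 2 ≤ 2 * gridEnergy m y := by
  have hS : 0 ≤ ∑ k ∈ Finset.range m, y (k + 1) ^ 2 := Finset.sum_nonneg fun _ _ => sq_nonneg _
  unfold gridEnergy
  rcases Nat.eq_zero_or_pos k with rfl | hpos
  · nlinarith [sq_nonneg (y (m + 1))]
  rcases hk.eq_or_lt with rfl | hlt
  · nlinarith [sq_nonneg (y 0)]
  obtain ⟨j, rfl⟩ : ∃ j, k = j + 1 := ⟨k - 1, by omega⟩
  have hj : y (j + 1) ^ 2 ≤ ∑ k ∈ Finset.range m, y (k + 1) ^ 2 :=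
    Finset.single_le_sum (f := fun k => y (k + 1) ^ 2) (fun _ _ => sq_nonneg _)
      (Finset.mem_range.2 (by omega))
  nlinarith [sq_nonneg (y 0), sq_nonneg (y (m + 1))]

theorem gridEnergy_le (m : ℕ) (y : ℕ → ℝ) :
    gridEnergy m y ≤ (m + 1) * 2 ^ (m + 1) *
      (y (m + 1) ^ 2 + ∑ j ∈ Finset.range (m + 1), (y (j + 1) - y j) ^ 2) := by
  have hP := sq_le_two_pow_mul_sum_sq y (m + 1)
  set B := 2 ^ (m + 1) *
    (y (m + 1) ^ 2 + ∑ j ∈ Finset.range (m + 1), (y (j + 1) - y j) ^ 2) with hB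
  have hS : ∑ k ∈ Finset.range m, y (k + 1) ^ 2 ≤ m * B := by
    simpa using Finset.sum_le_card_nsmul (Finset.range m) (fun k => y (k + 1) ^ 2) B
      fun k hk => hP (k + 1) (by have := Finset.mem_range.1 hk; omega)
  unfold gridEnergy
  rw [mul_assoc, ← hB]
  linarith [hP 0 (by omega), hP (m + 1) le_rfl]

/-- A function with `V' ≤ -c V` on `[0, ∞)` decays exponentially. -/
theorem le_mul_exp_neg_of_hasDerivWithinAt_le {V V' : ℝ → ℝ} {c : ℝ}
    (hV : ∀ t, 0 ≤ t → HasDerivWithinAt V (V' t) (Ici 0) t)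
    (hle : ∀ t, 0 ≤ t → V' t ≤ -c * V t) {t : ℝ} (ht : 0 ≤ t) :
    V t ≤ V 0 * Real.exp (-c * t) := by
  have hd : ∀ s, 0 ≤ s → HasDerivWithinAt (fun s => V s * Real.exp (c * s))
      (V' s * Real.exp (c * s) + V s * (Real.exp (c * s) * (c * 1))) (Ici 0) s := fun s hs =>
    (hV s hs).mul (((hasDerivAt_id s).const_mul c).exp.hasDerivWithinAt)
  have hanti : AntitoneOn (fun s => V s * Real.exp (c * s)) (Ici 0) := by
    refine antitoneOn_of_hasDerivWithinAt_nonpos (convex_Ici 0)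
      (fun s hs => (hd s hs).continuousWithinAt)
      (fun s hs => (hd s (interior_subset hs)).mono interior_subset) fun s hs => ?_
    nlinarith [hle s (interior_subset hs), Real.exp_pos (c * s)]
  have h0 : V t * Real.exp (c * t) ≤ V 0 := by
    simpa using hanti (mem_Ici.2 le_rfl) (mem_Ici.2 ht) ht
  calc V t = V t * Real.exp (c * t) * Real.exp (-c * t) := by
        rw [mul_assoc, ← Real.exp_add]; simp
    _ ≤ V 0 * Real.exp (-c * t) := by gcongr

/-- Along the linear system, the energy is dissipated by the gradient and the boundary term. -/
theorem hasDerivWithinAt_gridEnergy {m : ℕ} {h : ℝ} {Y : ℝ → Fin (m + 2) → ℝ} {t : ℝ} {s : Set ℝ}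
    (hY : HasDerivWithinAt Y (lField (m + 2) h (Y t)) s t) :
    HasDerivWithinAt (fun t => gridEnergy m (coordFn (Y t)))
      (-(2 / h ^ 2) * ∑ k ∈ Finset.range (m + 1),
          (coordFn (Y t) (k + 1) - coordFn (Y t) k) ^ 2
        - 2 / h * coordFn (Y t) (m + 1) ^ 2) s t := by
  have hc : ∀ n (hn : n < m + 2), HasDerivWithinAt (fun t => coordFn (Y t) n)
      (lField (m + 2) h (Y t) ⟨n, hn⟩) s t := fun n hn => by
    simpa only [coordFn, dif_pos hn] using hasDerivWithinAt_pi.1 hY ⟨n, hn⟩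
  have h0 := ((hc 0 (by omega)).pow 2).div_const 2
  have h1 := ((hc (m + 1) (by omega)).pow 2).div_const 2
  have hS : HasDerivWithinAt (fun t => ∑ k ∈ Finset.range m, coordFn (Y t) (k + 1) ^ 2)
      (∑ k ∈ Finset.range m, 2 / h ^ 2 * (coordFn (Y t) (k + 1) *
        (coordFn (Y t) (k + 2) - 2 * coordFn (Y t) (k + 1) + coordFn (Y t) k))) s t := by
    refine HasDerivWithinAt.fun_sum fun k hk => ?_
    have hkm := Finset.mem_range.1 hk
    refine ((hc (k + 1) (by omega)).pow 2).congr_deriv ?_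
    simp [lField, hkm.ne]
    ring
  refine ((h0.add hS).add h1).congr_deriv ?_
  rw [← Finset.mul_sum]
  simp [lField]
  linear_combination (2 / h ^ 2) * sum_mul_laplacian_eq_neg_sum_sq (coordFn (Y t)) m

/-- Solutions of the linear system have exponentially decaying energy. -/
theorem exists_gridEnergy_le_mul_exp {m : ℕ} {h : ℝ} (hh : 0 < h) {Y : ℝ → Fin (m + 2) → ℝ}
    (hY : ∀ t : ℝ, 0 ≤ t → HasDerivWithinAt Y (lField (m + 2) h (Y t)) (Ici 0) t) :
    ∃ c > 0, ∀ t, 0 ≤ t → gridEnergy m (coordFn (Y t)) ≤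
      gridEnergy m (coordFn (Y 0)) * Real.exp (-c * t) := by
  have ha : 0 < min (2 / h ^ 2) (2 / h) := by positivity
  have hK : (0 : ℝ) < (m + 1) * 2 ^ (m + 1) := by positivity
  refine ⟨min (2 / h ^ 2) (2 / h) / ((m + 1) * 2 ^ (m + 1)), by positivity, fun t ht =>
    le_mul_exp_neg_of_hasDerivWithinAt_le (V := fun t => gridEnergy m (coordFn (Y t)))
      (fun t ht => hasDerivWithinAt_gridEnergy (hY t ht)) (fun t _ => ?_) ht⟩
  have hS : 0 ≤ ∑ k ∈ Finset.range (m + 1), (coordFn (Y t) (k + 1) - coordFn (Y t) k) ^ 2 :=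
    Finset.sum_nonneg fun _ _ => sq_nonneg _
  have hE := mul_le_mul_of_nonneg_left (gridEnergy_le m (coordFn (Y t))) (div_pos ha hK).le
  rw [← mul_assoc, div_mul_cancel₀ _ hK.ne'] at hE
  have h1 := mul_le_mul_of_nonneg_right (min_le_left (2 / h ^ 2) (2 / h)) hS
  have h2 := mul_le_mul_of_nonneg_right (min_le_right (2 / h ^ 2) (2 / h))
    (sq_nonneg (coordFn (Y t) (m + 1)))
  linarith

/-- every (globally defined) solution of the linear system (L) is bounded and
converges to the origin. -/
theorem stmt15 (d : ℕ) (hd : 2 ≤ d) (h : ℝ) (hh : 0 < h)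
    (Y : ℝ → Fin d → ℝ)
    (hY : ∀ t : ℝ, 0 ≤ t → HasDerivWithinAt Y (lField d h (Y t)) (Set.Ici 0) t) :
    (∃ C : ℝ, ∀ t : ℝ, 0 ≤ t → euclNorm (Y t) ≤ C) ∧
    Filter.Tendsto Y Filter.atTop (nhds (0 : Fin d → ℝ)) := by
  obtain ⟨m, rfl⟩ : ∃ m, d = m + 2 := ⟨d - 2, by omega⟩
  obtain ⟨c, hc, hE⟩ := exists_gridEnergy_le_mul_exp hh hY
  set E₀ := gridEnergy m (coordFn (Y 0))
  have hsq : ∀ t, 0 ≤ t → ∀ i, Y t i ^ 2 ≤ 2 * (E₀ * Real.exp (-c * t)) := fun t ht i => by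
    have hi := sq_le_two_mul_gridEnergy m (coordFn (Y t)) i (by omega)
    rw [coordFn, dif_pos i.isLt] at hi
    linarith [hE t ht]
  have hE₀ : 0 ≤ E₀ := by
    have h0 := hsq 0 le_rfl 0
    simp only [mul_zero, Real.exp_zero, mul_one] at h0
    linarith [sq_nonneg (Y 0 0)]
  constructor
  · refine ⟨Real.sqrt (∑ _i : Fin (m + 2), 2 * E₀), fun t ht =>
      Real.sqrt_le_sqrt (Finset.sum_le_sum fun i _ => (hsq t ht i).trans ?_)⟩
    have hexp : Real.exp (-c * t) ≤ 1 := Real.exp_le_one_iff.2 (by nlinarith)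
    nlinarith
  · refine tendsto_pi_nhds.2 fun i => ?_
    have hlim : Tendsto (fun t => 2 * (E₀ * Real.exp (-c * t))) atTop (𝓝 0) := by
      have h1 : Tendsto (fun t : ℝ => Real.exp (-c * t)) atTop (𝓝 0) :=
        Real.tendsto_exp_atBot.comp (tendsto_id.const_mul_atTop_of_neg (neg_lt_zero.2 hc))
      simpa using (h1.const_mul E₀).const_mul 2
    have hsq0 : Tendsto (fun t => Y t i ^ 2) atTop (𝓝 0) :=
      tendsto_of_tendsto_of_tendsto_of_le_of_le' tendsto_const_nhds hlim
        (Eventually.of_forall fun _ => sq_nonneg _)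
        ((eventually_ge_atTop 0).mono fun t ht => hsq t ht i)
    refine (tendsto_zero_iff_abs_tendsto_zero _).2 ?_
    simpa [Function.comp_def, Real.sqrt_sq_eq_abs] using hsq0.sqrt
end

section
/- (Comparison with the linear system) Let T > 0, let U : [0,T] → ℝ^d be a solution of system (1.1), and let Y : [0,T] → ℝ^d be a solution of the linear system (L). If Y_k(0) ≤ U_k(0) for every k ∈ {1,…,d}, then Y_k(t) ≤ U_k(t) for every k ∈ {1,…,d} and every t ∈ [0,T]. -/
open scoped BigOperators
open Filter Topology Set

/-- A minimum principle: a family of functions, initially nonnegative, stays nonnegative if a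
component that is both negative and minimal among all components always has nonnegative
derivative. -/
theorem nonneg_of_deriv_nonneg_of_isMin {ι : Type*} [Finite ι] {T : ℝ}
    {W W' : ℝ → ι → ℝ}
    (hW : ∀ t ∈ Icc 0 T, ∀ k, HasDerivWithinAt (fun s => W s k) (W' t k) (Icc 0 T) t)
    (h0 : ∀ k, 0 ≤ W 0 k)
    (hmin : ∀ t ∈ Icc 0 T, ∀ k, (∀ j, W t k ≤ W t j) → W t k < 0 → 0 ≤ W' t k) :
    ∀ t ∈ Icc 0 T, ∀ k, 0 ≤ W t k := by
  intro t ht k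
  have hT : 0 ≤ T := ht.1.trans ht.2
  have key : ∀ ε > 0, 0 ≤ W t k + ε * t := by
    intro ε hε
    have hd : ∀ s ∈ Icc 0 T, ∀ j,
        HasDerivWithinAt (fun s => W s j + ε * s) (W' s j + ε) (Icc 0 T) s := fun s hs j => by
      simpa using (hW s hs j).fun_add ((hasDerivWithinAt_id s (Icc 0 T)).const_mul ε)
    have hex : ∀ j, ∃ s ∈ Icc 0 T, IsMinOn (fun s => W s j + ε * s) (Icc 0 T) s := fun j =>
      isCompact_Icc.exists_isMinOn (nonempty_Icc.2 hT)
        fun s hs => (hd s hs j).continuousWithinAt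
    choose τ hτ hτmin using hex
    have : Nonempty ι := ⟨k⟩
    obtain ⟨m, hm⟩ := Finite.exists_min fun j => W (τ j) j + ε * τ j
    have hglob : ∀ s ∈ Icc 0 T, ∀ j, W (τ m) m + ε * τ m ≤ W s j + ε * s := fun s hs j =>
      (hm j).trans (hτmin j hs)
    refine le_trans ?_ (hglob t ht k)
    by_contra! hneg
    have hτ0 : 0 < τ m := by
      refine lt_of_le_of_ne (hτ m).1 fun h => ?_
      rw [← h] at hneg
      linarith [h0 m]
    have hpos := hmin (τ m) (hτ m) m (fun j => by linarith [hglob _ (hτ m) j])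
      (by nlinarith)
    have hcone : (0 - τ m) ∈ posTangentConeAt (Icc 0 T) (τ m) :=
      sub_mem_posTangentConeAt_of_segment_subset
        ((convex_Icc 0 T).segment_subset (hτ m) (left_mem_Icc.2 hT))
    have hder := (hτmin m).localize.hasFDerivWithinAt_nonneg
      (hd _ (hτ m) m).hasFDerivWithinAt hcone
    simp only [ContinuousLinearMap.toSpanSingleton_apply, smul_eq_mul] at hder
    nlinarith
  rcases ht.1.eq_or_lt with rfl | htpos
  · exact h0 k
  · refine le_of_forall_pos_le_add fun δ hδ => ?_
    have := key (δ / t) (by positivity)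
    rwa [div_mul_cancel₀ _ htpos.ne'] at this

/-- Quasi-monotonicity of the pair of vector fields at a negative minimum of `u - y`. -/
theorem lField_le_bField_of_isMin {d : ℕ} (hd : 2 ≤ d) {h : ℝ} (p : ℝ) (hh : 0 < h)
    (u y : Fin d → ℝ) (k : Fin d) (hk : ∀ j, u k - y k ≤ u j - y j) (hneg : u k - y k < 0) :
    lField d h y k ≤ bField d h p u k := by
  have hc : ∀ n < d, u k - y k ≤ coordFn u n - coordFn y n := fun n hn => by
    simpa [coordFn, hn] using hk ⟨n, hn⟩
  have hu : u k = coordFn u k := by simp [coordFn]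
  have hy : y k = coordFn y k := by simp [coordFn]
  have hkd := k.isLt
  rw [hu, hy] at hc hneg
  unfold lField bField
  split_ifs with hk0 hkl
  · have h1 := hc 1 (by omega)
    rw [hk0] at h1
    gcongr ?_ * ?_
    linarith
  · have h1 := hc (d - 2) (by omega)
    rw [hkl] at h1 hneg
    have hmax : 0 ≤ max (coordFn u (d - 1)) 0 ^ p := Real.rpow_nonneg (le_max_right _ _) p
    have e : 2 / h * coordFn y (d - 1) = 2 / h ^ 2 * (h * coordFn y (d - 1)) := by
      field_simp
    rw [e, ← mul_sub]
    gcongr ?_ * ?_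
    nlinarith [mul_nonneg hh.le hmax]
  · have h1 := hc (k + 1) (by omega)
    have h2 := hc (k - 1) (by omega)
    gcongr ?_ * ?_
    linarith

/-- Comparison with the linear system: if `U` solves (1.1) and `Y` solves (L)
on `[0,T]` with `Y(0) ≤ U(0)` componentwise, then `Y(t) ≤ U(t)` componentwise on `[0,T]`. -/
theorem stmt16 (d : ℕ) (hd : 2 ≤ d) (h p T : ℝ) (hh : 0 < h) (hp : 1 < p) (hT : 0 < T)
    (U Y : ℝ → Fin d → ℝ)
    (hU : ∀ t ∈ Set.Icc 0 T, HasDerivWithinAt U (bField d h p (U t)) (Set.Icc 0 T) t)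
    (hY : ∀ t ∈ Set.Icc 0 T, HasDerivWithinAt Y (lField d h (Y t)) (Set.Icc 0 T) t)
    (h0 : ∀ k : Fin d, Y 0 k ≤ U 0 k) :
    ∀ t ∈ Set.Icc 0 T, ∀ k : Fin d, Y t k ≤ U t k := by
  intro t ht k
  refine sub_nonneg.1 (nonneg_of_deriv_nonneg_of_isMin (T := T) (W := fun s j => U s j - Y s j)
    (W' := fun s j => bField d h p (U s) j - lField d h (Y s) j) ?_
    (fun j => sub_nonneg.2 (h0 j)) ?_ t ht k)
  · exact fun s hs j =>
      (hasDerivWithinAt_pi.1 (hU s hs) j).sub (hasDerivWithinAt_pi.1 (hY s hs) j)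
  · exact fun s _ j hj hneg =>
      sub_nonneg.2 (lField_le_bField_of_isMin hd p hh (U s) (Y s) j hj hneg)
end

section
/- (Positivity for the cooperative differential inequality) Let T > 0 and let Z : [0,T] → ℝ^d be differentiable with Z_k(0) ≥ 0 for all k ∈ {1,…,d}, and suppose that for every t ∈ [0,T]: Z_1'(t) ≥ (2/h²)(−Z_1(t) + Z_2(t)), Z_i'(t) ≥ (1/h²)(Z_{i+1}(t) − 2Z_i(t) + Z_{i−1}(t)) for 2 ≤ i ≤ d−1, and Z_d'(t) ≥ (2/h²)(−Z_d(t) + Z_{d−1}(t)) − (2/h)Z_d(t). Then Z_k(t) ≥ 0 for every k ∈ {1,…,d} and every t ∈ [0,T]. -/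
open scoped BigOperators
open Filter Topology Set

/-- At a minimum over `[0, T]` attained after time `0` the derivative is nonpositive. -/
theorem HasDerivWithinAt.nonpos_of_isMinOn_Icc {f : ℝ → ℝ} {f' T t : ℝ} (ht : t ∈ Icc 0 T)
    (ht0 : 0 < t) (hf : HasDerivWithinAt f f' (Icc 0 T) t) (hmin : IsMinOn f (Icc 0 T) t) :
    f' ≤ 0 := by
  have hseg : segment ℝ t 0 ⊆ Icc 0 T :=
    (convex_Icc (0 : ℝ) T).segment_subset ht ⟨le_rfl, ht.1.trans ht.2⟩
  have key := hmin.localize.hasFDerivWithinAt_nonneg hf.hasFDerivWithinAt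
    (sub_mem_posTangentConeAt_of_segment_subset hseg)
  rw [ContinuousLinearMap.toSpanSingleton_apply, smul_eq_mul] at key
  nlinarith

/-- A differentiable vector-valued function that starts nonnegative stays nonnegative if, whenever
its smallest component is negative, that component has nonnegative derivative. -/
theorem nonneg_of_deriv_nonneg_at_negative_min {ι : Type*} [Fintype ι] {T : ℝ}
    {Z Z' : ℝ → ι → ℝ}
    (hderiv : ∀ t ∈ Icc 0 T, HasDerivWithinAt Z (Z' t) (Icc 0 T) t)
    (h0 : ∀ k, 0 ≤ Z 0 k)
    (hmin : ∀ t ∈ Icc 0 T, ∀ k, Z t k < 0 → (∀ j, Z t k ≤ Z t j) → 0 ≤ Z' t k) :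
    ∀ t ∈ Icc 0 T, ∀ k, 0 ≤ Z t k := by
  intro t₀ ht₀ k₀
  by_contra! hneg
  have ht₀pos : 0 < t₀ := ht₀.1.lt_of_ne fun he => (h0 k₀).not_gt (he ▸ hneg)
  obtain ⟨ε, hε, hεt⟩ : ∃ ε > 0, Z t₀ k₀ + ε * t₀ < 0 := by
    refine ⟨-Z t₀ k₀ / (2 * t₀), by apply div_pos <;> linarith, ?_⟩
    have : -Z t₀ k₀ / (2 * t₀) * t₀ = -Z t₀ k₀ / 2 := by field_simp
    linarith
  have hder : ∀ k, ∀ t ∈ Icc 0 T,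
      HasDerivWithinAt (fun s => Z s k + ε * s) (Z' t k + ε) (Icc 0 T) t := fun k t ht => by
    simpa only [id, mul_one] using (hasDerivWithinAt_pi.1 (hderiv t ht) k).fun_add
      ((hasDerivWithinAt_id t (Icc 0 T)).const_mul ε)
  choose τ hτ hτmin using fun k => isCompact_Icc.exists_isMinOn ⟨t₀, ht₀⟩
    fun t ht => (hder k t ht).continuousWithinAt
  have : Nonempty ι := ⟨k₀⟩
  obtain ⟨k, hk⟩ := Finite.exists_min fun k => Z (τ k) k + ε * τ k
  have hle : ∀ j, ∀ t ∈ Icc 0 T, Z (τ k) k + ε * τ k ≤ Z t j + ε * t :=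
    fun j t ht => (hk j).trans (hτmin j ht)
  have hlt : Z (τ k) k + ε * τ k < 0 := (hle k₀ t₀ ht₀).trans_lt hεt
  have hτ0 : 0 ≤ ε * τ k := mul_nonneg hε.le (hτ k).1
  have hτpos : 0 < τ k := (hτ k).1.lt_of_ne fun he => by
    have := h0 k
    rw [← he] at hlt
    linarith
  have hZ' := hmin (τ k) (hτ k) k (by linarith) fun j => by linarith [hle j (τ k) (hτ k)]
  have := (hder k (τ k) (hτ k)).nonpos_of_isMinOn_Icc (hτ k) hτpos (hτmin k)
  linarith

/-- Positivity for the cooperative differential inequality: if `Z : [0,T] → ℝ^d`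
is differentiable, starts componentwise nonnegative, and its derivative `Z'` satisfies the
stated cooperative differential inequalities, then `Z` stays componentwise nonnegative. -/
theorem stmt17 (d : ℕ) (hd : 2 ≤ d) (h T : ℝ) (hh : 0 < h) (hT : 0 < T)
    (Z Z' : ℝ → Fin d → ℝ)
    (hderiv : ∀ t ∈ Set.Icc 0 T, HasDerivWithinAt Z (Z' t) (Set.Icc 0 T) t)
    (h0 : ∀ k : Fin d, 0 ≤ Z 0 k)
    (hineq1 : ∀ t ∈ Set.Icc (0 : ℝ) T,
      (2 / h ^ 2) * (-coordFn (Z t) 0 + coordFn (Z t) 1) ≤ coordFn (Z' t) 0)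
    (hineqMid : ∀ t ∈ Set.Icc (0 : ℝ) T, ∀ i : Fin d, 0 < (i : ℕ) → (i : ℕ) < d - 1 →
      (1 / h ^ 2) * (coordFn (Z t) ((i : ℕ) + 1) - 2 * coordFn (Z t) (i : ℕ)
        + coordFn (Z t) ((i : ℕ) - 1)) ≤ Z' t i)
    (hineqd : ∀ t ∈ Set.Icc (0 : ℝ) T,
      (2 / h ^ 2) * (-coordFn (Z t) (d - 1) + coordFn (Z t) (d - 2))
        - (2 / h) * coordFn (Z t) (d - 1) ≤ coordFn (Z' t) (d - 1)) :
    ∀ t ∈ Set.Icc 0 T, ∀ k : Fin d, 0 ≤ Z t k := by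
  refine nonneg_of_deriv_nonneg_at_negative_min hderiv h0 fun t ht k hneg hmin => ?_
  have hcoord : ∀ n, n < d → Z t k ≤ coordFn (Z t) n := fun n hn => by
    rw [coordFn_of_lt _ hn]
    exact hmin _
  have hself : ∀ u : Fin d → ℝ, coordFn u k = u k := fun u => coordFn_of_lt u k.2
  rcases Nat.eq_zero_or_pos (k : ℕ) with hk | hk
  · have hle := hineq1 t ht
    have hself0 : ∀ u : Fin d → ℝ, coordFn u 0 = u k := fun u => by rw [← hself u, hk]
    rw [hself0, hself0] at hle
    refine le_trans (mul_nonneg (by positivity) ?_) hle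
    linarith [hcoord 1 (by omega)]
  rcases lt_or_ge (k : ℕ) (d - 1) with hkd | hkd
  · refine le_trans (mul_nonneg (by positivity) ?_) (hineqMid t ht k hk hkd)
    rw [hself]
    linarith [hcoord (k + 1) (by omega), hcoord (k - 1) (by omega)]
  · have hle := hineqd t ht
    rw [show d - 1 = (k : ℕ) by omega, hself, hself] at hle
    have h1 : 0 ≤ 2 / h ^ 2 * (-Z t k + coordFn (Z t) (d - 2)) :=
      mul_nonneg (by positivity) (by linarith [hcoord (d - 2) (by omega)])
    have h2 : 2 / h * Z t k ≤ 0 := mul_nonpos_of_nonneg_of_nonpos (by positivity) hneg.le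
    linarith
end

section
/- (One-dimensional blow-up estimate) Let p > 1, α > 0 and M > 0, and let T ≥ M^{1−p}/(α(p−1)). Then there is no continuous function f : [0,T] → ℝ satisfying f(t) ≥ M + α ∫₀ᵗ f(s)^p ds for all t ∈ [0,T]. -/
open scoped BigOperators
open Set

/-- A continuous function that is positive at each time up to which it has been positive
is positive throughout. -/
lemma pos_of_continuousOn_of_forall_lt {f : ℝ → ℝ} {T : ℝ} (hf : ContinuousOn f (Icc 0 T))
    (h : ∀ t ∈ Icc 0 T, (∀ s ∈ Ico 0 t, 0 < f s) → 0 < f t) :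
    ∀ t ∈ Icc 0 T, 0 < f t := by
  by_contra! ⟨t, ht, hft⟩
  have hcomp : IsCompact (Icc 0 T ∩ f ⁻¹' Iic 0) :=
    isCompact_Icc.of_isClosed_subset (hf.preimage_isClosed_of_isClosed isClosed_Icc isClosed_Iic)
      inter_subset_left
  obtain ⟨t₀, ⟨ht₀, hft₀⟩, hmin⟩ := hcomp.exists_isLeast ⟨t, ht, hft⟩
  refine (h t₀ ht₀ fun s hs => ?_).not_ge hft₀
  by_contra! hfs
  exact hs.2.not_ge (hmin ⟨⟨hs.1, hs.2.le.trans ht₀.2⟩, hfs⟩)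

/-- A positive solution of `G' ≥ α G ^ p` with `p > 1` satisfies
`G(T) ^ (1 - p) + α (p - 1) T ≤ G(0) ^ (1 - p)`. -/
lemma rpow_add_le_of_deriv_ge_rpow {p α T : ℝ} (hp : 1 < p) (hT : 0 ≤ T) {G G' : ℝ → ℝ}
    (hcont : ContinuousOn G (Icc 0 T)) (hpos : ∀ t ∈ Icc 0 T, 0 < G t)
    (hderiv : ∀ t ∈ Ioo 0 T, HasDerivAt G (G' t) t)
    (hG' : ∀ t ∈ Ioo 0 T, α * G t ^ p ≤ G' t) :
    G T ^ (1 - p) + α * (p - 1) * T ≤ G 0 ^ (1 - p) := by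
  have hanti : AntitoneOn (fun t => G t ^ (1 - p) + α * (p - 1) * t) (Icc 0 T) := by
    refine antitoneOn_of_hasDerivWithinAt_nonpos (convex_Icc 0 T)
      (f' := fun t => G' t * (1 - p) * G t ^ (1 - p - 1) + α * (p - 1)) ?_ ?_ ?_
    · exact (hcont.rpow_const fun t ht => Or.inl (hpos t ht).ne').add (by fun_prop)
    · rw [interior_Icc]
      intro t ht
      have hGt := hpos t (Ioo_subset_Icc_self ht)
      exact (((hderiv t ht).rpow_const (Or.inl hGt.ne')).add
        (hasDerivAt_const_mul (α * (p - 1)))).hasDerivWithinAt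
    · rw [interior_Icc]
      intro t ht
      have hGt := hpos t (Ioo_subset_Icc_self ht)
      have hinv : G t ^ p * G t ^ (1 - p - 1) = 1 := by
        rw [← Real.rpow_add hGt]
        simp
      have hge : α ≤ G' t * G t ^ (1 - p - 1) := by
        calc α = α * G t ^ p * G t ^ (1 - p - 1) := by rw [mul_assoc, hinv, mul_one]
          _ ≤ _ := mul_le_mul_of_nonneg_right (hG' t ht) (Real.rpow_nonneg hGt.le _)
      nlinarith
  simpa using hanti (left_mem_Icc.2 hT) (right_mem_Icc.2 hT) hT

/-- One-dimensional blow-up estimate: for `p > 1`, `α > 0`, `M > 0` and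
`T ≥ M^{1-p}/(α(p-1))`, there is no continuous `f : [0,T] → ℝ` with
`f(t) ≥ M + α ∫₀ᵗ f(s)^p ds` for all `t ∈ [0,T]`. -/
theorem stmt18 (p α M T : ℝ) (hp : 1 < p) (hα : 0 < α) (hM : 0 < M)
    (hT : M ^ (1 - p) / (α * (p - 1)) ≤ T) :
    ¬ ∃ f : ℝ → ℝ, ContinuousOn f (Set.Icc 0 T) ∧
      ∀ t ∈ Set.Icc (0 : ℝ) T, M + α * ∫ s in (0 : ℝ)..t, f s ^ p ≤ f t := by
  rintro ⟨f, hf, hle⟩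
  have hc : 0 < α * (p - 1) := mul_pos hα (sub_pos.2 hp)
  have hT0 : 0 ≤ T := le_trans (by positivity) hT
  have hpos : ∀ t ∈ Icc 0 T, 0 < f t := by
    refine pos_of_continuousOn_of_forall_lt hf fun t ht hlt => ?_
    have hint : 0 ≤ ∫ s in (0 : ℝ)..t, f s ^ p := by
      rw [intervalIntegral.integral_of_le ht.1, MeasureTheory.integral_Ioc_eq_integral_Ioo]
      exact MeasureTheory.setIntegral_nonneg measurableSet_Ioo fun s hs =>
        Real.rpow_nonneg (hlt s (Ioo_subset_Ico_self hs)).le p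
    have := hle t ht
    have := mul_nonneg hα.le hint
    linarith
  have hfp : ContinuousOn (fun s => f s ^ p) (Icc 0 T) :=
    hf.rpow_const fun t ht => Or.inl (hpos t ht).ne'
  have hGpos : ∀ t ∈ Icc 0 T, 0 < M + α * ∫ s in (0 : ℝ)..t, f s ^ p := fun t ht =>
    add_pos_of_pos_of_nonneg hM <| mul_nonneg hα.le <|
      intervalIntegral.integral_nonneg ht.1 fun s hs =>
        Real.rpow_nonneg (hpos s ⟨hs.1, hs.2.trans ht.2⟩).le p
  have hprim : ContinuousOn (fun t => ∫ s in (0 : ℝ)..t, f s ^ p) (Icc 0 T) := by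
    rw [← uIcc_of_le hT0] at hfp ⊢
    exact intervalIntegral.continuousOn_primitive_interval
      (hfp.integrableOn_compact isCompact_uIcc)
  have hblow := rpow_add_le_of_deriv_ge_rpow (α := α) hp hT0
    (G := fun t => M + α * ∫ s in (0 : ℝ)..t, f s ^ p) (G' := fun t => α * f t ^ p)
    (continuousOn_const.add (continuousOn_const.mul hprim)) hGpos
    (fun t ht => by
      have hft := hfp.mono Ioo_subset_Icc_self
      exact ((intervalIntegral.integral_hasDerivAt_right
        ((hfp.mono (Icc_subset_Icc_right ht.2.le)).intervalIntegrable_of_Icc ht.1.le)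
        (hft.stronglyMeasurableAtFilter isOpen_Ioo t ht)
        (hft.continuousAt (isOpen_Ioo.mem_nhds ht))).const_mul α).const_add M)
    (fun t ht => by
      have ht' := Ioo_subset_Icc_self ht
      exact mul_le_mul_of_nonneg_left
        (Real.rpow_le_rpow (hGpos t ht').le (hle t ht') (by linarith)) hα.le)
  have hGT := Real.rpow_pos_of_pos (hGpos T (right_mem_Icc.2 hT0)) (1 - p)
  rw [div_le_iff₀' hc] at hT
  simp only [intervalIntegral.integral_same, mul_zero, add_zero] at hblow
  linarith
end

section
/- (Blow-up before a fixed time for large initial data) Let p > 1 and α₁, α₂ > 0 be real numbers and let δ > 0. Then there exists M₀ > 0 such that for every M ≥ M₀ there is no differentiable function f : [0,δ] → ℝ satisfying f(0) ≥ M and f'(t) ≥ −α₁·M + α₂·f(t)^p for all t ∈ [0,δ]. (In particular, the blow-up time of any solution of the differential inequality f' ≥ −α₁M + α₂ f^p with f(0) ≥ M tends to 0 as M → ∞.) -/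
open scoped BigOperators
open Set

/-- A function with right derivative positive wherever it takes the value `M` stays above `M`. -/
lemma le_of_hasDerivWithinAt_pos_of_eq {f f' : ℝ → ℝ} {a b M : ℝ}
    (hf : ∀ t ∈ Icc a b, HasDerivWithinAt f (f' t) (Icc a b) t) (ha : M ≤ f a)
    (hpos : ∀ t ∈ Ico a b, f t = M → 0 < f' t) : ∀ t ∈ Icc a b, M ≤ f t := by
  intro t ht
  refine image_le_of_deriv_right_lt_deriv_boundary' (f := fun _ ↦ M) (f' := fun _ ↦ 0)
    continuousOn_const (fun x _ ↦ hasDerivWithinAt_const x _ M) ha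
    (fun x hx ↦ (hf x hx).continuousWithinAt) (B' := f') (fun x hx ↦ ?_)
    (fun x hx h ↦ hpos x hx h.symm) ht
  exact (hf x (Ico_subset_Icc_self hx)).mono_of_mem_nhdsWithin (Icc_mem_nhdsGE_of_mem hx)

/-- A positive function with `f' ≥ c * f ^ p`, where `p > 1`, blows up in finite time: its
interval of existence is bounded in terms of `f a`. -/
lemma mul_sub_lt_rpow_of_mul_rpow_le_deriv {f f' : ℝ → ℝ} {a b c p : ℝ} (hp : 1 < p)
    (hab : a ≤ b) (hf : ∀ t ∈ Icc a b, HasDerivWithinAt f (f' t) (Icc a b) t)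
    (hpos : ∀ t ∈ Icc a b, 0 < f t) (hle : ∀ t ∈ Icc a b, c * f t ^ p ≤ f' t) :
    (p - 1) * c * (b - a) < f a ^ (1 - p) := by
  have hderiv : ∀ t ∈ Icc a b, HasDerivWithinAt (fun s ↦ f s ^ (1 - p))
      (f' t * (1 - p) * f t ^ (1 - p - 1)) (Icc a b) t := fun t ht ↦
    (hf t ht).rpow_const (Or.inl (hpos t ht).ne')
  have hline : ∀ t, HasDerivAt (fun s ↦ f a ^ (1 - p) - (p - 1) * c * (s - a))
      (-((p - 1) * c)) t := fun t ↦ by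
    simpa using (((hasDerivAt_id t).sub_const a).const_mul ((p - 1) * c)).const_sub (f a ^ (1 - p))
  have hbound : f b ^ (1 - p) ≤ f a ^ (1 - p) - (p - 1) * c * (b - a) := by
    refine image_le_of_deriv_right_le_deriv_boundary (f := fun s ↦ f s ^ (1 - p))
      (fun t ht ↦ (hderiv t ht).continuousWithinAt)
      (fun t ht ↦ (hderiv t (Ico_subset_Icc_self ht)).mono_of_mem_nhdsWithin
        (Icc_mem_nhdsGE_of_mem ht)) (by simp)
      (fun t _ ↦ (hline t).continuousAt.continuousWithinAt)
      (fun t _ ↦ (hline t).hasDerivWithinAt) (fun t ht ↦ ?_) (right_mem_Icc.2 hab)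
    have ht' := Ico_subset_Icc_self ht
    have hinv : f t ^ p * f t ^ (1 - p - 1) = 1 := by
      rw [← Real.rpow_add (hpos t ht')]
      simp
    have hc : c ≤ f' t * f t ^ (1 - p - 1) := by
      have := mul_le_mul_of_nonneg_right (hle t ht') (Real.rpow_nonneg (hpos t ht').le (1 - p - 1))
      rwa [mul_assoc, hinv, mul_one] at this
    nlinarith
  linarith [Real.rpow_pos_of_pos (hpos b (right_mem_Icc.2 hab)) (1 - p)]

/-- Blow-up before a fixed time for large initial data: for `p > 1`,
`α₁, α₂ > 0` and `δ > 0` there is `M₀ > 0` such that for every `M ≥ M₀` no differentiable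
`f : [0,δ] → ℝ` satisfies `f(0) ≥ M` and `f'(t) ≥ -α₁·M + α₂·f(t)^p` on `[0,δ]`
(reading `f(t)^p` as `(max(f(t),0))^p`). -/
theorem stmt19 (p α₁ α₂ δ : ℝ) (hp : 1 < p) (hα₁ : 0 < α₁) (hα₂ : 0 < α₂) (hδ : 0 < δ) :
    ∃ M₀ : ℝ, 0 < M₀ ∧ ∀ M : ℝ, M₀ ≤ M →
      ¬ ∃ f f' : ℝ → ℝ,
        (∀ t ∈ Set.Icc 0 δ, HasDerivWithinAt f (f' t) (Set.Icc 0 δ) t) ∧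
        M ≤ f 0 ∧
        ∀ t ∈ Set.Icc (0 : ℝ) δ, -α₁ * M + α₂ * (max (f t) 0) ^ p ≤ f' t := by
  have hp' : 0 < p - 1 := sub_pos.2 hp
  obtain ⟨N, hN⟩ := Filter.eventually_atTop.1 <| (tendsto_rpow_atTop hp').eventually_ge_atTop
    (max (2 * α₁ / α₂) (((p - 1) * (α₂ / 2) * δ)⁻¹))
  refine ⟨max N 1, by positivity, fun M hM ↦ ?_⟩
  rintro ⟨f, f', hf, h0, hle⟩
  have hM0 : 0 < M := one_pos.trans_le ((le_max_right _ _).trans hM)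
  obtain ⟨hK₁, hK₂⟩ := max_le_iff.1 (hN M ((le_max_left _ _).trans hM))
  have hMp : M ^ p = M * M ^ (p - 1) := by
    rw [Real.rpow_sub_one hM0.ne']
    field_simp
  have hα : α₁ * M ≤ α₂ / 2 * M ^ p := by
    rw [div_le_iff₀ hα₂] at hK₁
    rw [hMp]
    nlinarith
  have hge : ∀ t ∈ Icc 0 δ, M ≤ f t := by
    refine le_of_hasDerivWithinAt_pos_of_eq hf h0 fun t ht h ↦ ?_
    have := hle t (Ico_subset_Icc_self ht)
    rw [h, max_eq_left hM0.le] at this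
    nlinarith [mul_pos hα₂ (Real.rpow_pos_of_pos hM0 p)]
  have hlt := mul_sub_lt_rpow_of_mul_rpow_le_deriv (c := α₂ / 2) hp hδ.le hf
    (fun t ht ↦ hM0.trans_le (hge t ht)) fun t ht ↦ by
      have := hle t ht
      rw [max_eq_left (hM0.le.trans (hge t ht))] at this
      nlinarith [Real.rpow_le_rpow hM0.le (hge t ht) (zero_le_one.trans hp.le)]
  have hanti : f 0 ^ (1 - p) ≤ M ^ (1 - p) :=
    Real.rpow_le_rpow_of_nonpos hM0 h0 (by linarith)
  have hinv : M ^ (1 - p) ≤ (p - 1) * (α₂ / 2) * δ := by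
    rw [← neg_sub p 1, Real.rpow_neg hM0.le]
    exact inv_le_of_inv_le₀ (by positivity) hK₂
  rw [sub_zero] at hlt
  linarith
end
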